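/- Let G be a 3-connected, cubic, bipartite graph with a non-trivial tight cut ∂X. Then G is 2-factor Hamiltonian if and only if both tight cut contractions associated with ∂X are 2-factor Hamiltonian. -/

import Mathlib

open SimpleGraph

/-- A graph is cubic if every vertex has degree 3. -/
def IsCubic {V : Type*} (G : SimpleGraph V) : Prop :=
  ∀ v : V, (G.neighborSet v).ncard = 3

/-- A 2-factor of `G` is a 2-regular spanning subgraph of `G`. -/
def IsTwoFactor {V : Type*} (G : SimpleGraph V) (H : G.Subgraph) : Prop :=
  H.IsSpanning ∧ ∀ v : V, (H.neighborSet v).ncard = 2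

/-- A graph is 2-factor Hamiltonian if every 2-factor of it is a Hamiltonian cycle,
i.e. a connected 2-regular spanning subgraph. -/
def IsTwoFactorHamiltonian {V : Type*} (G : SimpleGraph V) : Prop :=
  ∀ H : G.Subgraph, IsTwoFactor G H → H.Connected

/-- A brace is a connected bipartite graph on at least four vertices in which every
matching of size at most two is contained in a perfect matching. -/
def IsBrace {V : Type*} (G : SimpleGraph V) : Prop :=
  G.Connected ∧ G.Colorable 2 ∧ 4 ≤ Nat.card V ∧
    ∀ M : G.Subgraph, M.IsMatching → M.edgeSet.ncard ≤ 2 →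
      ∃ P : G.Subgraph, M ≤ P ∧ P.IsPerfectMatching

/-- The Heawood graph, as the point-line incidence graph of the Fano plane:
points and lines are indexed by `Fin 7`, and point `p` lies on line `l` iff
`p + l ∈ {0, 1, 3}` (mod 7), `{0,1,3}` being a planar difference set mod 7. -/
def heawoodGraph : SimpleGraph (Fin 7 ⊕ Fin 7) :=
  SimpleGraph.fromRel fun a b => ∃ p l : Fin 7,
    a = Sum.inl p ∧ b = Sum.inr l ∧ (p + l = 0 ∨ p + l = 1 ∨ p + l = 3)

/-- A cycle (given as a closed walk) alternates between edges of the subgraph `M`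
and edges not in `M`; the wrap-around pair is included by appending the first edge. -/
def IsAlternatingCycle {V : Type*} {G : SimpleGraph V} (M : G.Subgraph) {v : V}
    (p : G.Walk v v) : Prop :=
  p.IsCycle ∧
    List.Chain' (fun e f => e ∈ M.edgeSet ↔ f ∉ M.edgeSet) (p.edges ++ p.edges.take 1)

/-- `σ` is a Pfaffian orientation of `G`: it orients every edge (exactly one direction),
and for every perfect matching `M` and every `M`-alternating cycle, the number of
its edges oriented in agreement with the direction of traversal is odd. -/
def IsPfaffianOrientation {V : Type*} (G : SimpleGraph V) (σ : V → V → Bool) : Prop :=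
  (∀ u v : V, G.Adj u v → σ u v = !σ v u) ∧
  ∀ M : G.Subgraph, M.IsPerfectMatching →
    ∀ (v : V) (p : G.Walk v v), IsAlternatingCycle M p →
      Odd (p.darts.filter fun d => σ d.toProd.1 d.toProd.2).length

/-- A graph with a perfect matching is Pfaffian if it admits a Pfaffian orientation. -/
def IsPfaffian {V : Type*} (G : SimpleGraph V) : Prop :=
  (∃ M : G.Subgraph, M.IsPerfectMatching) ∧ ∃ σ : V → V → Bool, IsPfaffianOrientation G σ

/-- The cut `∂X`: the set of edges of `G` with exactly one endpoint in `X`. -/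
def edgeCut {V : Type*} (G : SimpleGraph V) (X : Set V) : Set (Sym2 V) :=
  {e | e ∈ G.edgeSet ∧ ∃ u w : V, e = s(u, w) ∧ u ∈ X ∧ w ∉ X}

/-- A cut `∂X` is tight if every perfect matching contains exactly one of its edges. -/
def IsTightCut {V : Type*} (G : SimpleGraph V) (X : Set V) : Prop :=
  ∀ M : G.Subgraph, M.IsPerfectMatching → (edgeCut G X ∩ M.edgeSet).ncard = 1

/-- A cut `∂X` is trivial if `|X| = 1` or `|V(G) \ X| = 1`. -/
def IsTrivialCut {V : Type*} (X : Set V) : Prop :=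
  X.ncard = 1 ∨ (Xᶜ : Set V).ncard = 1

/-- The tight cut contraction keeping `X`: contract `V(G) \ X` into a single vertex
(`Sum.inr ()`), deleting loops and parallel edges. -/
def contractOutside {V : Type*} (G : SimpleGraph V) (X : Set V) :
    SimpleGraph (↥X ⊕ Unit) :=
  SimpleGraph.fromRel fun a b =>
    (∃ u v : X, a = Sum.inl u ∧ b = Sum.inl v ∧ G.Adj u v) ∨
    (∃ (u : X) (w : V), w ∉ X ∧ a = Sum.inl u ∧ b = Sum.inr () ∧ G.Adj u w)

/-- A graph is `k`-connected if it has more than `k` vertices and deleting any set of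
fewer than `k` vertices leaves it connected. -/
def IsKConnected {V : Type*} (k : ℕ) (G : SimpleGraph V) : Prop :=
  k < Nat.card V ∧ ∀ S : Set V, S.ncard < k → (G.induce (Sᶜ : Set V)).Connected

/-- A graph is matching covered if it is connected, has an edge, and every edge
lies in a perfect matching. -/
def IsMatchingCovered {V : Type*} (G : SimpleGraph V) : Prop :=
  G.Connected ∧ G.edgeSet.Nonempty ∧
    ∀ e ∈ G.edgeSet, ∃ M : G.Subgraph, M.IsPerfectMatching ∧ e ∈ M.edgeSet

/-- A graph is bridgeless if no edge is a bridge. -/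
def Bridgeless {V : Type*} (G : SimpleGraph V) : Prop :=
  ∀ e : Sym2 V, ¬ G.IsBridge e

/-- `(A, B)` is a bipartition of `G` into the two colour classes `A` and `B`. -/
def IsBipartition {V : Type*} (G : SimpleGraph V) (A B : Set V) : Prop :=
  A ∪ B = Set.univ ∧ Disjoint A B ∧
    ∀ u v : V, G.Adj u v → ((u ∈ A ∧ v ∈ B) ∨ (u ∈ B ∧ v ∈ A))

/-- `G` is the star product `(G1,v1)*(G2,v2)`, witnessed by the embeddings `f` of
`G1 - v1` and `g` of `G2 - v2` into `G`, and the bijection `m` matching the three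
neighbours of `v1` to the three neighbours of `v2`: `v1` and `v2` have degree 3,
the images of `f` and `g` partition the vertices of `G`, and the edges of `G` are
exactly the edges of `G1 - v1`, the edges of `G2 - v2`, and the three matching edges
`f x — g (m x)` for `x` a neighbour of `v1`. -/
def IsStarProductWitness {V V1 V2 : Type*} (G : SimpleGraph V)
    (G1 : SimpleGraph V1) (v1 : V1) (G2 : SimpleGraph V2) (v2 : V2)
    (f : V1 → V) (g : V2 → V) (m : V1 → V2) : Prop :=
  (G1.neighborSet v1).ncard = 3 ∧ (G2.neighborSet v2).ncard = 3 ∧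
  Set.InjOn f {x | x ≠ v1} ∧ Set.InjOn g {y | y ≠ v2} ∧
  (∀ x y, x ≠ v1 → y ≠ v2 → f x ≠ g y) ∧
  (∀ v : V, (∃ x, x ≠ v1 ∧ f x = v) ∨ (∃ y, y ≠ v2 ∧ g y = v)) ∧
  Set.BijOn m (G1.neighborSet v1) (G2.neighborSet v2) ∧
  (∀ a b : V, G.Adj a b ↔
    ((∃ x y, x ≠ v1 ∧ y ≠ v1 ∧ G1.Adj x y ∧ a = f x ∧ b = f y) ∨
     (∃ x y, x ≠ v2 ∧ y ≠ v2 ∧ G2.Adj x y ∧ a = g x ∧ b = g y) ∨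
     (∃ x, G1.Adj v1 x ∧ ((a = f x ∧ b = g (m x)) ∨ (b = f x ∧ a = g (m x))))))

/-- `G` is a star product `(G1,v1)*(G2,v2)`. -/
def IsStarProduct {V V1 V2 : Type*} (G : SimpleGraph V)
    (G1 : SimpleGraph V1) (v1 : V1) (G2 : SimpleGraph V2) (v2 : V2) : Prop :=
  ∃ (f : V1 → V) (g : V2 → V) (m : V1 → V2),
    IsStarProductWitness G G1 v1 G2 v2 f g m

/-- The principal 3-edge cut of a star product: the three added matching edges. -/
def principalCut {V V1 V2 : Type*} (G1 : SimpleGraph V1) (v1 : V1)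
    (f : V1 → V) (g : V2 → V) (m : V1 → V2) : Set (Sym2 V) :=
  {e | ∃ x, G1.Adj v1 x ∧ e = s(f x, g (m x))}

section PerfectMatchings

variable {V : Type*} {G : SimpleGraph V}

/-- A perfect matching of `G`, encoded as the involution exchanging matched vertices. -/
structure IsMatchingInvolution (G : SimpleGraph V) (m : V → V) : Prop where
  adj : ∀ v, G.Adj v (m v)
  invol : ∀ v, m (m v) = v

/-- A regular bipartite graph of positive degree has a perfect matching. -/
theorem exists_isMatchingInvolution [Finite V] (hbip : G.Colorable 2) {k : ℕ} (hk : 0 < k)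
    (hreg : ∀ v, (G.neighborSet v).ncard = k) : ∃ m, IsMatchingInvolution G m := by
  classical
  have := Fintype.ofFinite V
  have hdeg (v : V) : (G.neighborFinset v).card = k := by
    rw [← hreg v, ← Set.ncard_coe_finset, coe_neighborFinset]
  obtain ⟨f, hf, hadj⟩ := (Finset.all_card_le_biUnion_card_iff_exists_injective
    fun v => G.neighborFinset v).mp fun s => by
      refine Nat.le_of_mul_le_mul_right (c := k) ?_ hk
      refine Finset.card_mul_le_card_mul G.Adj (fun a ha => ?_) fun b _ => ?_
      · rw [← hdeg a]
        refine Finset.card_le_card fun b hb => ?_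
        simp only [Finset.mem_bipartiteAbove, Finset.mem_biUnion]
        exact ⟨⟨a, ha, hb⟩, by simpa using hb⟩
      · rw [← hdeg b]
        refine Finset.card_le_card fun a ha => ?_
        simpa [adj_comm] using (Finset.mem_bipartiteBelow _).mp ha |>.2
  simp only [mem_neighborFinset] at hadj
  let e := Equiv.ofBijective f (Finite.injective_iff_bijective.mp hf)
  have he (v : V) : G.Adj v (e v) := hadj v
  have hsymm (v : V) : G.Adj v (e.symm v) := by simpa using (he (e.symm v)).symm
  obtain ⟨c⟩ := hbip
  refine ⟨fun v => if c v = 0 then e v else e.symm v, fun v => ?_, fun v => ?_⟩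
  · split_ifs
    exacts [he v, hsymm v]
  · by_cases h : c v = 0
    · have : c (e v) ≠ 0 := h ▸ (c.valid (he v)).symm
      simp [h, this]
    · have : c (e.symm v) = 0 := by
        have := c.valid (hsymm v)
        omega
      simp [h, this]

/-- Deleting a perfect matching lowers every degree by one. -/
theorem exists_le_ncard_neighborSet_of_isMatchingInvolution [Finite V] {m : V → V}
    (hm : IsMatchingInvolution G m) {k : ℕ} (hreg : ∀ v, (G.neighborSet v).ncard = k + 1) :
    ∃ K : SimpleGraph V, (∀ a b, K.Adj a b ↔ G.Adj a b ∧ m a ≠ b) ∧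
      ∀ v, (K.neighborSet v).ncard = k := by
  let K : SimpleGraph V :=
    { Adj := fun a b => G.Adj a b ∧ m a ≠ b
      symm := ⟨fun a b h => ⟨h.1.symm, fun hba => h.2 (hba ▸ hm.invol b)⟩⟩
      loopless := ⟨fun a h => G.loopless.irrefl a h.1⟩ }
  refine ⟨K, fun a b => Iff.rfl, fun v => ?_⟩
  have : K.neighborSet v = G.neighborSet v \ {m v} := by
    ext b
    simp [K, eq_comm]
  rw [this, Set.ncard_sdiff_singleton_of_mem ((G.mem_neighborSet v _).mpr (hm.adj v)), hreg v,
    Nat.add_sub_cancel]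

/-- A cubic bipartite graph decomposes into three perfect matchings. -/
theorem exists_three_isMatchingInvolution [Finite V] (hbip : G.Colorable 2) (hcubic : IsCubic G) :
    ∃ m₁ m₂ m₃, IsMatchingInvolution G m₁ ∧ IsMatchingInvolution G m₂ ∧
      IsMatchingInvolution G m₃ ∧ ∀ a b, G.Adj a b → m₁ a = b ∨ m₂ a = b ∨ m₃ a = b := by
  obtain ⟨m₁, h₁⟩ := exists_isMatchingInvolution hbip (by norm_num) hcubic
  obtain ⟨K, hK, hKreg⟩ := exists_le_ncard_neighborSet_of_isMatchingInvolution h₁ hcubic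
  have hKG : K ≤ G := fun a b h => ((hK a b).mp h).1
  obtain ⟨m₂, h₂⟩ := exists_isMatchingInvolution (hbip.mono_left hKG) (by norm_num) hKreg
  obtain ⟨L, hL, hLreg⟩ := exists_le_ncard_neighborSet_of_isMatchingInvolution h₂ hKreg
  have hLK : L ≤ K := fun a b h => ((hL a b).mp h).1
  obtain ⟨m₃, h₃⟩ :=
    exists_isMatchingInvolution (hbip.mono_left (hLK.trans hKG)) (by norm_num) hLreg
  refine ⟨m₁, m₂, m₃, h₁, ⟨fun v => hKG (h₂.adj v), h₂.invol⟩,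
    ⟨fun v => hKG (hLK (h₃.adj v)), h₃.invol⟩, fun a b hab => ?_⟩
  by_contra! h
  obtain ⟨c, hc⟩ := Set.ncard_eq_one.mp (hLreg a)
  have hb : b ∈ L.neighborSet a := (hL a b).mpr ⟨(hK a b).mpr ⟨hab, h.1⟩, h.2.1⟩
  have hma : m₃ a ∈ L.neighborSet a := h₃.adj a
  rw [hc] at hb hma
  exact h.2.2 (hma.trans hb.symm)

/-- The edges outside a 2-factor of a cubic graph form a perfect matching. -/
theorem IsTwoFactor.exists_isMatchingInvolution [Finite V] (hcubic : IsCubic G) {H : G.Subgraph}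
    (hH : IsTwoFactor G H) :
    ∃ m, IsMatchingInvolution G m ∧ ∀ a b, G.Adj a b → (m a = b ↔ ¬ H.Adj a b) := by
  have hone (v : V) : ∃ w, G.neighborSet v \ H.neighborSet v = {w} := by
    rw [← Set.ncard_eq_one, Set.ncard_sdiff (H.neighborSet_subset v), hcubic v, hH.2 v]
  choose m hm using hone
  have hiff (a b : V) : m a = b ↔ G.Adj a b ∧ ¬ H.Adj a b := by
    have : b ∈ G.neighborSet a \ H.neighborSet a ↔ b ∈ ({m a} : Set V) := by rw [hm a]
    simpa [eq_comm] using this.symm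
  refine ⟨m, ⟨fun v => ((hiff v _).mp rfl).1, fun v => ?_⟩, fun a b hab => by simp [hiff, hab]⟩
  have := (hiff v _).mp rfl
  exact (hiff _ _).mpr ⟨this.1.symm, fun h => this.2 h.symm⟩

/-- A perfect matching crosses a tight cut in exactly one edge. -/
theorem IsTightCut.exists_unique_crossing {X : Set V} (htight : IsTightCut G X) {m : V → V}
    (hm : IsMatchingInvolution G m) : ∃ p ∈ X, ∀ a ∈ X, m a ∉ X ↔ a = p := by
  let M : G.Subgraph :=
    { verts := Set.univ
      Adj := fun a b => m a = b
      adj_sub := by rintro a _ rfl; exact hm.adj a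
      edge_vert := fun _ => Set.mem_univ _
      symm := ⟨by rintro a _ rfl; exact hm.invol a⟩ }
  have hM : M.IsPerfectMatching :=
    Subgraph.isPerfectMatching_iff.mpr fun v => ⟨m v, rfl, fun w hw => Eq.symm (a := m v) hw⟩
  obtain ⟨e, he⟩ := Set.ncard_eq_one.mp (htight M hM)
  have hmem : e ∈ edgeCut G X ∩ M.edgeSet := he ▸ rfl
  obtain ⟨⟨-, p, q, rfl, hp, hq⟩, hpq⟩ := hmem
  have hpq : m p = q := hpq
  refine ⟨p, hp, fun a ha => ⟨fun hma => ?_, fun h => by rwa [h, hpq]⟩⟩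
  have : s(a, m a) ∈ edgeCut G X ∩ M.edgeSet :=
    ⟨⟨hm.adj a, a, m a, rfl, ha, hma⟩, show m a = m a from rfl⟩
  rw [he, Set.mem_singleton_iff, Sym2.eq_iff] at this
  rcases this with h | h
  · exact h.1
  · exact absurd (h.1 ▸ ha) hq

end PerfectMatchings

section MatchingCuts

variable {V : Type*} {G : SimpleGraph V} {X : Set V}

/-- The endpoints in `X` of the pairs related by `r` that leave `X`. -/
def cutEnds (r : V → V → Prop) (X : Set V) : Set V :=
  {a | a ∈ X ∧ ∃ b, b ∉ X ∧ r a b}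

/-- The cut `∂X` consists of three edges with distinct ends in `X`, and every perfect matching contains
exactly one of them. -/
structure IsTightThreeCut (G : SimpleGraph V) (X : Set V) : Prop where
  out_unique : ∀ {a b c}, a ∈ X → b ∉ X → c ∉ X → G.Adj a b → G.Adj a c → b = c
  ncard_cutEnds : (cutEnds G.Adj X).ncard = 3
  crossing : ∀ m, IsMatchingInvolution G m → ∃ p ∈ X, ∀ a ∈ X, m a ∉ X ↔ a = p

/-- In a 3-connected graph no two vertices cover a cut with a further vertex on each side. -/
theorem IsKConnected.not_cover_cut (h3con : IsKConnected 3 G) {S : Set V} (hS : S.ncard < 3)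
    {x y : V} (hx : x ∈ X) (hxS : x ∉ S) (hy : y ∉ X) (hyS : y ∉ S)
    (hcover : ∀ a b, a ∈ X → b ∉ X → G.Adj a b → a ∈ S ∨ b ∈ S) : False := by
  have hr := (h3con.2 S hS).preconnected ⟨x, hxS⟩ ⟨y, hyS⟩
  rw [reachable_iff_reflTransGen] at hr
  have hstay : ∀ z, Relation.ReflTransGen (G.induce Sᶜ).Adj ⟨x, hxS⟩ z → (z : V) ∈ X := by
    intro z hz
    induction hz with
    | refl => exact hx
    | @tail b c _ hbc ih =>
      by_contra hc
      exact (hcover b c ih hc hbc).elim b.2 c.2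
  exact hy (hstay _ hr)

theorem isTightThreeCut [Finite V] (h3con : IsKConnected 3 G) (hcubic : IsCubic G)
    (hbip : G.Colorable 2) (htight : IsTightCut G X) (hnontriv : ¬ IsTrivialCut X) :
    IsTightThreeCut G X := by
  obtain ⟨m₁, m₂, m₃, h₁, h₂, h₃, hcov⟩ := exists_three_isMatchingInvolution hbip hcubic
  obtain ⟨p₁, hp₁, hu₁⟩ := htight.exists_unique_crossing h₁
  obtain ⟨p₂, hp₂, hu₂⟩ := htight.exists_unique_crossing h₂
  obtain ⟨p₃, hp₃, hu₃⟩ := htight.exists_unique_crossing h₃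
  have hq₁ := (hu₁ p₁ hp₁).mpr rfl
  have hq₂ := (hu₂ p₂ hp₂).mpr rfl
  have hq₃ := (hu₃ p₃ hp₃).mpr rfl
  have hcut : ∀ a b, a ∈ X → b ∉ X → G.Adj a b →
      (a = p₁ ∧ b = m₁ p₁) ∨ (a = p₂ ∧ b = m₂ p₂) ∨ (a = p₃ ∧ b = m₃ p₃) := by
    intro a b ha hb hab
    rcases hcov a b hab with rfl | rfl | rfl
    · obtain rfl := (hu₁ a ha).mp hb
      simp
    · obtain rfl := (hu₂ a ha).mp hb
      simp
    · obtain rfl := (hu₃ a ha).mp hb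
      simp
  have hX (s : V) : ∃ x ∈ X, x ≠ s := by
    by_contra! h
    exact hnontriv (.inl (Set.ncard_eq_one.mpr ⟨p₁, Set.eq_singleton_iff_unique_mem.mpr
      ⟨hp₁, fun x hx => (h x hx).trans (h p₁ hp₁).symm⟩⟩))
  have hXc (s : V) : ∃ x ∉ X, x ≠ s := by
    by_contra! h
    exact hnontriv (.inr (Set.ncard_eq_one.mpr ⟨m₁ p₁, Set.eq_singleton_iff_unique_mem.mpr
      ⟨hq₁, fun x hx => (h x hx).trans (h _ hq₁).symm⟩⟩))
  have hpair (s t : V) (hs : s ∈ X) (ht : t ∉ X) :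
      ¬ ∀ a b, a ∈ X → b ∉ X → G.Adj a b → a = s ∨ b = t := by
    intro h
    obtain ⟨x, hx, hxs⟩ := hX s
    obtain ⟨y, hy, hyt⟩ := hXc t
    refine h3con.not_cover_cut (S := {s, t}) ((Set.ncard_insert_le s {t}).trans_lt (by simp))
      hx ?_ hy ?_ fun a b ha hb hab => ?_
    · simp only [Set.mem_insert_iff, Set.mem_singleton_iff, not_or]
      exact ⟨hxs, fun h => ht (h ▸ hx)⟩
    · simp only [Set.mem_insert_iff, Set.mem_singleton_iff, not_or]
      exact ⟨fun h => hy (h ▸ hs), hyt⟩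
    · rcases h a b ha hb hab with rfl | rfl <;> simp
  have hp₁₂ : p₁ ≠ p₂ := fun h => hpair p₁ (m₃ p₃) hp₁ hq₃ fun a b ha hb hab => by
    rcases hcut a b ha hb hab with h | h | h <;> grind
  have hp₁₃ : p₁ ≠ p₃ := fun h => hpair p₁ (m₂ p₂) hp₁ hq₂ fun a b ha hb hab => by
    rcases hcut a b ha hb hab with h | h | h <;> grind
  have hp₂₃ : p₂ ≠ p₃ := fun h => hpair p₂ (m₁ p₁) hp₂ hq₁ fun a b ha hb hab => by
    rcases hcut a b ha hb hab with h | h | h <;> grind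
  refine ⟨fun {a b c} ha hb hc hab hac => ?_, ?_,
    fun m hm => htight.exists_unique_crossing hm⟩
  · have := hcut a b ha hb hab
    have := hcut a c ha hc hac
    grind
  · have : cutEnds G.Adj X = {p₁, p₂, p₃} := by
      ext a
      constructor
      · rintro ⟨ha, b, hb, hab⟩
        rcases hcut a b ha hb hab with h | h | h <;> simp [h.1]
      · rintro (rfl | rfl | rfl)
        exacts [⟨hp₁, _, hq₁, h₁.adj _⟩, ⟨hp₂, _, hq₂, h₂.adj _⟩, ⟨hp₃, _, hq₃, h₃.adj _⟩]
    rw [this, Set.ncard_eq_three]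
    exact ⟨p₁, p₂, p₃, hp₁₂, hp₁₃, hp₂₃, rfl⟩

theorem edgeCut_compl : edgeCut G Xᶜ = edgeCut G X := by
  ext e
  constructor <;> rintro ⟨he, u, w, rfl, hu, hw⟩
  · exact ⟨he, w, u, Sym2.eq_swap, by simpa using hw, hu⟩
  · exact ⟨he, w, u, Sym2.eq_swap, hw, by simpa using hu⟩

theorem IsTightCut.compl (h : IsTightCut G X) : IsTightCut G Xᶜ := by
  intro M hM
  rw [edgeCut_compl]
  exact h M hM

theorem not_isTrivialCut_compl (h : ¬ IsTrivialCut X) : ¬ IsTrivialCut Xᶜ := by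
  rw [IsTrivialCut, compl_compl, or_comm]
  exact h

end MatchingCuts

section Contraction

variable {V : Type*} {G : SimpleGraph V} {X : Set V}

open Classical in
/-- The contraction map sending all vertices outside `X` to the contraction vertex. -/
noncomputable def contractMap (X : Set V) (a : V) : ↥X ⊕ Unit :=
  if h : a ∈ X then Sum.inl ⟨a, h⟩ else Sum.inr ()

theorem contractMap_of_mem {a : V} (h : a ∈ X) : contractMap X a = Sum.inl ⟨a, h⟩ :=
  dif_pos h

theorem contractMap_of_notMem {a : V} (h : a ∉ X) : contractMap X a = Sum.inr () :=
  dif_neg h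

theorem contractMap_eq_of_mem {a b : V} (ha : a ∈ X) (h : contractMap X a = contractMap X b) :
    a = b := by
  by_cases hb : b ∈ X
  · simpa [contractMap_of_mem, ha, hb] using h
  · simp [contractMap_of_mem ha, contractMap_of_notMem hb] at h

theorem contractMap_surjective (hX : ∃ a, a ∉ X) : Function.Surjective (contractMap X) := by
  rintro (⟨a, ha⟩ | ⟨⟩)
  · exact ⟨a, contractMap_of_mem ha⟩
  · obtain ⟨a, ha⟩ := hX
    exact ⟨a, contractMap_of_notMem ha⟩

theorem contractOutside_adj_iff {a : V} (ha : a ∈ X) {y : ↥X ⊕ Unit} :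
    (contractOutside G X).Adj (contractMap X a) y ↔ ∃ b, G.Adj a b ∧ contractMap X b = y := by
  rw [contractMap_of_mem ha, contractOutside, fromRel_adj]
  constructor
  · rintro ⟨-, (⟨u, v, hu, rfl, h⟩ | ⟨u, w, hw, hu, rfl, h⟩) |
      (⟨u, v, rfl, hv, h⟩ | ⟨u, w, -, -, hw, -⟩)⟩
    · obtain rfl := Sum.inl_injective hu
      exact ⟨v, h, contractMap_of_mem v.2⟩
    · obtain rfl := Sum.inl_injective hu
      exact ⟨w, h, contractMap_of_notMem hw⟩
    · obtain rfl := Sum.inl_injective hv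
      exact ⟨u, h.symm, contractMap_of_mem u.2⟩
    · cases hw
  · rintro ⟨b, hab, rfl⟩
    by_cases hb : b ∈ X
    · rw [contractMap_of_mem hb]
      refine ⟨fun h => hab.ne (by simpa using h), .inl (.inl ⟨_, _, rfl, rfl, hab⟩)⟩
    · rw [contractMap_of_notMem hb]
      exact ⟨by simp, .inl (.inr ⟨_, b, hb, rfl, rfl, hab⟩)⟩

theorem contractOutside_adj {a b : V} (hab : G.Adj a b)
    (hne : contractMap X a ≠ contractMap X b) :
    (contractOutside G X).Adj (contractMap X a) (contractMap X b) := by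
  by_cases ha : a ∈ X
  · exact (contractOutside_adj_iff ha).mpr ⟨b, hab, rfl⟩
  · by_cases hb : b ∈ X
    · exact ((contractOutside_adj_iff hb).mpr ⟨a, hab.symm, rfl⟩).symm
    · exact absurd (by rw [contractMap_of_notMem ha, contractMap_of_notMem hb]) hne

theorem IsTightThreeCut.contractMap_injOn (h : IsTightThreeCut G X) {a : V} (ha : a ∈ X) :
    Set.InjOn (contractMap X) (G.neighborSet a) := by
  intro b hb c hc hbc
  by_cases hbX : b ∈ X
  · exact contractMap_eq_of_mem hbX hbc
  · by_cases hcX : c ∈ X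
    · exact (contractMap_eq_of_mem hcX hbc.symm).symm
    · exact h.out_unique ha hbX hcX hb hc

/-- A spanning subgraph is connected if and only if it is so as a graph on all vertices. -/
theorem connected_iff_spanningCoe_connected {H : G.Subgraph} (h : H.IsSpanning) :
    H.Connected ↔ H.spanningCoe.Connected := by
  rw [SimpleGraph.Subgraph.connected_iff', (H.spanningCoeEquivCoeOfSpanning h).connected_iff]

/-- A graph is connected if a connected graph maps onto it with each edge sent to an edge or
collapsed to a vertex. -/
theorem connected_of_surjective {W : Type*} {H : SimpleGraph V} {K : SimpleGraph W}
    (hH : H.Connected) {f : V → W} (hf : Function.Surjective f)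
    (hadj : ∀ a b, H.Adj a b → f a ≠ f b → K.Adj (f a) (f b)) : K.Connected := by
  have := hH.nonempty
  refine connected_iff _ |>.mpr ⟨fun x y => ?_, Nonempty.map f this⟩
  obtain ⟨a, rfl⟩ := hf x
  obtain ⟨b, rfl⟩ := hf y
  have hab := hH.preconnected a b
  rw [reachable_iff_reflTransGen] at hab
  induction hab with
  | refl => exact Reachable.rfl
  | @tail b c _ hbc ih =>
    by_cases h : f b = f c
    · rwa [← h]
    · exact ih.trans (hadj b c hbc h).reachable

/-- A 2-factor of a contraction lifts to a 2-factor of the graph, so that 2-factor Hamiltonicity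
passes to tight cut contractions. -/
theorem IsTwoFactorHamiltonian.contractOutside [Finite V] (hG : IsTwoFactorHamiltonian G)
    (hcubic : IsCubic G) (hX : IsTightThreeCut G X)
    (hcov : ∀ a b, G.Adj a b → ∃ m, IsMatchingInvolution G m ∧ m a = b) :
    IsTwoFactorHamiltonian (contractOutside G X) := by
  intro H hH
  let T : Set V := {a | a ∈ X ∧ H.Adj (contractMap X a) (Sum.inr ())}
  have hTsub : T ⊆ cutEnds G.Adj X := by
    rintro a ⟨ha, hadj⟩
    obtain ⟨b, hab, hb⟩ := (contractOutside_adj_iff ha).mp hadj.adj_sub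
    refine ⟨ha, b, fun hbX => ?_, hab⟩
    simp [contractMap_of_mem hbX] at hb
  have hTcard : T.ncard = 2 := by
    rw [← hH.2 (Sum.inr ()), ← Set.InjOn.ncard_image (f := contractMap X) (s := T)
      fun a ha b _ hab => contractMap_eq_of_mem ha.1 hab]
    congr 1
    ext y
    constructor
    · rintro ⟨a, ha, rfl⟩
      exact ha.2.symm
    · intro hy
      rcases y with ⟨a, ha⟩ | ⟨⟩
      · refine ⟨a, ⟨ha, ?_⟩, contractMap_of_mem ha⟩
        rw [contractMap_of_mem ha]
        exact hy.symm
      · exact absurd hy.adj_sub (SimpleGraph.irrefl _)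
  obtain ⟨p, hp⟩ : ∃ p, cutEnds G.Adj X \ T = {p} := by
    rw [← Set.ncard_eq_one, Set.ncard_sdiff hTsub, hX.ncard_cutEnds, hTcard]
  have hpmem : p ∈ cutEnds G.Adj X \ T := hp ▸ rfl
  obtain ⟨⟨hpX, q, hq, hpq⟩, hpT⟩ := hpmem
  obtain ⟨m, hm, rfl⟩ := hcov p q hpq
  have hcross : ∀ a ∈ X, m a ∉ X ↔ a = p := by
    obtain ⟨p', hp', h⟩ := hX.crossing m hm
    obtain rfl := (h p hpX).mp hq
    exact h
  have hcutEdge : ∀ a b, a ∈ X → b ∉ X → G.Adj a b →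
      (m a ≠ b ↔ H.Adj (contractMap X a) (contractMap X b)) := by
    intro a b ha hb hab
    rw [contractMap_of_notMem hb]
    have hT : H.Adj (contractMap X a) (Sum.inr ()) ↔ a ≠ p := by
      refine ⟨fun h hap => hpT (hap ▸ ⟨ha, h⟩), fun hap => ?_⟩
      by_contra h
      have : a ∈ cutEnds G.Adj X \ T := ⟨⟨ha, b, hb, hab⟩, fun h' => h h'.2⟩
      rw [hp] at this
      exact hap this
    rw [hT, not_iff_not, ← hcross a ha]
    exact ⟨fun h => h ▸ hb, fun h => hX.out_unique ha h hb (hm.adj a) hab⟩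
  have hmsymm (a b : V) : m a = b ↔ m b = a :=
    ⟨fun h => h ▸ hm.invol a, fun h => h ▸ hm.invol b⟩
  let L : G.Subgraph :=
    { verts := Set.univ
      Adj := fun a b => G.Adj a b ∧
        ((a ∈ X ∧ b ∈ X ∧ H.Adj (contractMap X a) (contractMap X b)) ∨
          (¬ (a ∈ X ∧ b ∈ X) ∧ m a ≠ b))
      adj_sub := And.left
      edge_vert := fun _ => Set.mem_univ _
      symm := ⟨by
        rintro a b ⟨hab, ⟨ha, hb, h⟩ | ⟨hn, h⟩⟩
        · exact ⟨hab.symm, .inl ⟨hb, ha, h.symm⟩⟩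
        · exact ⟨hab.symm, .inr ⟨fun h => hn h.symm, fun h' => h ((hmsymm a b).mpr h')⟩⟩⟩ }
  have hLin : ∀ a b, a ∈ X →
      (L.Adj a b ↔ G.Adj a b ∧ H.Adj (contractMap X a) (contractMap X b)) := by
    intro a b ha
    refine and_congr_right fun hab => ?_
    by_cases hb : b ∈ X
    · simp [ha, hb]
    · simp [hb, ← hcutEdge a b ha hb hab]
  have hL : IsTwoFactor G L := by
    refine ⟨fun v => Set.mem_univ v, fun a => ?_⟩
    by_cases ha : a ∈ X
    · have hinj : Set.InjOn (contractMap X) (L.neighborSet a) :=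
        (hX.contractMap_injOn ha).mono (L.neighborSet_subset a)
      rw [← hH.2 (contractMap X a), ← hinj.ncard_image]
      congr 1
      ext y
      constructor
      · rintro ⟨b, hb, rfl⟩
        exact ((hLin a b ha).mp hb).2
      · intro hy
        obtain ⟨b, hab, rfl⟩ := (contractOutside_adj_iff ha).mp hy.adj_sub
        exact ⟨b, (hLin a b ha).mpr ⟨hab, hy⟩, rfl⟩
    · have : L.neighborSet a = G.neighborSet a \ {m a} := by
        ext b
        change (_ ∧ _) ↔ _
        simp [ha, eq_comm]
      rw [this, Set.ncard_sdiff_singleton_of_mem ((G.mem_neighborSet a _).mpr (hm.adj a)),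
        hcubic a]
  have hLconn := (connected_iff_spanningCoe_connected hL.1).mp (hG L hL)
  refine (connected_iff_spanningCoe_connected hH.1).mpr
    (connected_of_surjective hLconn (contractMap_surjective ⟨_, hq⟩) fun a b hab hne => ?_)
  by_cases ha : a ∈ X
  · exact ((hLin a b ha).mp hab).2
  · by_cases hb : b ∈ X
    · exact ((hLin b a hb).mp hab.symm).2.symm
    · exact absurd (by rw [contractMap_of_notMem ha, contractMap_of_notMem hb]) hne

/-- A 2-factor uses exactly two edges of a tight cut. -/
theorem IsTightThreeCut.ncard_cutEnds_of_isTwoFactor [Finite V] (hX : IsTightThreeCut G X)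
    (hcubic : IsCubic G) {H : G.Subgraph} (hH : IsTwoFactor G H) :
    (cutEnds H.Adj X).ncard = 2 := by
  obtain ⟨m, hm, hmH⟩ := hH.exists_isMatchingInvolution hcubic
  obtain ⟨p, hp, hcross⟩ := hX.crossing m hm
  have hpm := (hcross p hp).mpr rfl
  have : cutEnds H.Adj X = cutEnds G.Adj X \ {p} := by
    ext a
    constructor
    · rintro ⟨ha, b, hb, hab⟩
      refine ⟨⟨ha, b, hb, hab.adj_sub⟩, ?_⟩
      rintro rfl
      exact (hmH a b hab.adj_sub).mp
        (hX.out_unique ha hpm hb (hm.adj a) hab.adj_sub) hab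
    · rintro ⟨⟨ha, b, hb, hab⟩, hap⟩
      refine ⟨ha, b, hb, ?_⟩
      by_contra h
      have := (hmH a b hab).mpr h
      exact hap ((hcross a ha).mp (this ▸ hb))
  have hpG : p ∈ cutEnds G.Adj X := ⟨hp, _, hpm, hm.adj p⟩
  rw [this, Set.ncard_sdiff_singleton_of_mem hpG, hX.ncard_cutEnds]

/-- By parity, the two ends in `X` of a 2-factor crossing a tight cut lie in one component. -/
theorem IsTightThreeCut.reachable_of_mem_cutEnds [Finite V] (hX : IsTightThreeCut G X)
    (hcubic : IsCubic G) {H : G.Subgraph} (hH : IsTwoFactor G H) {u v : V}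
    (hu : u ∈ cutEnds H.Adj X) (hv : v ∈ cutEnds H.Adj X) : H.spanningCoe.Reachable u v := by
  classical
  have := Fintype.ofFinite V
  let K : SimpleGraph V :=
    { Adj := fun a b => H.Adj a b ∧ a ∈ X ∧ b ∈ X ∧ H.spanningCoe.Reachable u a
      symm := ⟨fun a b h => ⟨h.1.symm, h.2.2.1, h.2.1,
        h.2.2.2.trans (Adj.reachable (G := H.spanningCoe) h.1)⟩⟩
      loopless := ⟨fun a h => G.loopless.irrefl a h.1.adj_sub⟩ }
  have hdeg (a : V) : K.degree a = (K.neighborSet a).ncard := by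
    rw [← card_neighborFinset_eq_degree, ← Set.ncard_coe_finset, coe_neighborFinset]
  obtain ⟨huX, c, hc, huc⟩ := hu
  have hKu : K.neighborSet u = H.neighborSet u \ {c} := by
    ext b
    constructor
    · rintro ⟨h, -, hb, -⟩
      exact ⟨h, fun hbc => hc (hbc ▸ hb)⟩
    · rintro ⟨h, hbc⟩
      refine ⟨h, huX, ?_, Reachable.rfl⟩
      by_contra hb
      exact hbc (hX.out_unique huX hb hc h.adj_sub huc.adj_sub)
  have hodd : Odd (K.degree u) := by
    rw [hdeg, hKu, Set.ncard_sdiff_singleton_of_mem ((H.mem_neighborSet u c).mpr huc), hH.2 u]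
    exact odd_one
  obtain ⟨w, hwu, hw⟩ := K.exists_ne_odd_degree_of_exists_odd_degree u hodd
  obtain ⟨d, hd⟩ := (K.degree_pos_iff_exists_adj w).mp hw.pos
  obtain ⟨-, hwX, -, huw⟩ := hd
  have hwT : w ∈ cutEnds H.Adj X := by
    by_contra hwT
    have : K.neighborSet w = H.neighborSet w := by
      ext b
      refine ⟨fun h => h.1, fun h => ⟨h, hwX, ?_, huw⟩⟩
      by_contra hb
      exact hwT ⟨hwX, b, hb, h⟩
    rw [hdeg, this, hH.2 w] at hw
    exact absurd hw (by decide)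
  have hpair : {u, w} = cutEnds H.Adj X := by
    refine Set.eq_of_subset_of_ncard_le ?_ ?_
    · rintro a (rfl | rfl)
      exacts [⟨huX, c, hc, huc⟩, hwT]
    · rw [hX.ncard_cutEnds_of_isTwoFactor hcubic hH, Set.ncard_pair hwu.symm]
  rw [← hpair] at hv
  rcases hv with rfl | rfl
  exacts [Reachable.rfl, huw]

/-- If a tight cut contraction is 2-factor Hamiltonian, then in a 2-factor of the graph every
vertex of the uncontracted side is joined to each end of the cut on that side. -/
theorem IsTightThreeCut.reachable_of_contractOutside [Finite V] (hX : IsTightThreeCut G X)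
    (hcubic : IsCubic G) (hC : IsTwoFactorHamiltonian (contractOutside G X)) {H : G.Subgraph}
    (hH : IsTwoFactor G H) {u a : V} (hu : u ∈ cutEnds H.Adj X) (ha : a ∈ X) :
    H.spanningCoe.Reachable a u := by
  let L : (contractOutside G X).Subgraph :=
    { verts := Set.univ
      Adj := fun y z => y ≠ z ∧ ∃ b c, H.Adj b c ∧ contractMap X b = y ∧ contractMap X c = z
      adj_sub := by
        rintro _ _ ⟨hne, b, c, hbc, rfl, rfl⟩
        exact contractOutside_adj hbc.adj_sub hne
      edge_vert := fun _ => Set.mem_univ _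
      symm := ⟨fun y z ⟨hne, b, c, hbc, hb, hc⟩ => ⟨hne.symm, c, b, hbc.symm, hc, hb⟩⟩ }
  have hL : IsTwoFactor (contractOutside G X) L := by
    refine ⟨fun v => Set.mem_univ v, fun y => ?_⟩
    by_cases hy : ∃ b, b ∈ X ∧ contractMap X b = y
    · obtain ⟨b, hb, rfl⟩ := hy
      have hinj : Set.InjOn (contractMap X) (H.neighborSet b) :=
        (hX.contractMap_injOn hb).mono (H.neighborSet_subset b)
      rw [← hH.2 b, ← hinj.ncard_image]
      congr 1
      ext z
      constructor
      · rintro ⟨-, b', c, hbc, hb', rfl⟩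
        obtain rfl := contractMap_eq_of_mem hb hb'.symm
        exact ⟨c, hbc, rfl⟩
      · rintro ⟨c, hbc, rfl⟩
        exact ⟨fun h => hbc.adj_sub.ne (contractMap_eq_of_mem hb h), b, c, hbc, rfl, rfl⟩
    · obtain rfl : y = Sum.inr () := by
        rcases y with ⟨b, hb⟩ | ⟨⟩
        · exact absurd ⟨b, hb, contractMap_of_mem hb⟩ hy
        · rfl
      rw [← hX.ncard_cutEnds_of_isTwoFactor hcubic hH,
        ← Set.InjOn.ncard_image (f := contractMap X) (s := cutEnds H.Adj X)
          fun b hb c _ hbc => contractMap_eq_of_mem hb.1 hbc]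
      congr 1
      ext z
      constructor
      · rintro ⟨hne, b, c, hbc, hb, rfl⟩
        have hbX : b ∉ X := fun h => by simp [contractMap_of_mem h] at hb
        have hcX : c ∈ X := by
          by_contra h
          exact hne (contractMap_of_notMem h).symm
        exact ⟨c, ⟨hcX, b, hbX, hbc.symm⟩, rfl⟩
      · rintro ⟨c, ⟨hc, b, hb, hcb⟩, rfl⟩
        exact ⟨by simp [contractMap_of_mem hc], b, c, hcb.symm, contractMap_of_notMem hb, rfl⟩
  have hLconn := (connected_iff_spanningCoe_connected hL.1).mp (hC L hL)
  have hr := hLconn.preconnected (contractMap X a) (Sum.inr ())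
  rw [reachable_iff_reflTransGen] at hr
  have key : ∀ y, Relation.ReflTransGen L.spanningCoe.Adj (contractMap X a) y →
      H.spanningCoe.Reachable a u ∨
        ∃ b ∈ X, contractMap X b = y ∧ H.spanningCoe.Reachable a b := by
    intro y hy
    induction hy with
    | refl => exact .inr ⟨a, ha, rfl, Reachable.rfl⟩
    | tail _ hyz ih =>
      rcases ih with h | ⟨b, hb, rfl, hab⟩
      · exact .inl h
      · obtain ⟨-, b', c, hbc, hb', rfl⟩ := hyz
        obtain rfl := contractMap_eq_of_mem hb hb'.symm
        by_cases hc : c ∈ X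
        · exact .inr ⟨c, hc, rfl, hab.trans (Adj.reachable (G := H.spanningCoe) hbc)⟩
        · exact .inl (hab.trans
            (hX.reachable_of_mem_cutEnds hcubic hH ⟨hb, c, hc, hbc⟩ hu))
  rcases key _ hr with h | ⟨b, hb, hb', -⟩
  · exact h
  · simp [contractMap_of_mem hb] at hb'

end Contraction

/-- Let `G` be a 3-connected, cubic, bipartite graph with a non-trivial
tight cut `∂X`. Then `G` is 2-factor Hamiltonian if and only if both tight cut
contractions associated with `∂X` are 2-factor Hamiltonian. -/
theorem twoFactorHamiltonian_iff_tightCutContractions {V : Type*} [Fintype V]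
    (G : SimpleGraph V) (X : Set V)
    (h3con : IsKConnected 3 G) (hcubic : IsCubic G) (hbip : G.Colorable 2)
    (htight : IsTightCut G X) (hnontriv : ¬ IsTrivialCut X) :
    IsTwoFactorHamiltonian G ↔
      (IsTwoFactorHamiltonian (contractOutside G X) ∧
       IsTwoFactorHamiltonian (contractOutside G (Xᶜ : Set V))) := by
  have hX := isTightThreeCut h3con hcubic hbip htight hnontriv
  have hXc := isTightThreeCut h3con hcubic hbip htight.compl (not_isTrivialCut_compl hnontriv)
  constructor
  · intro hG
    have hcov : ∀ a b, G.Adj a b → ∃ m, IsMatchingInvolution G m ∧ m a = b := by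
      obtain ⟨m₁, m₂, m₃, h₁, h₂, h₃, hcov⟩ := exists_three_isMatchingInvolution hbip hcubic
      intro a b hab
      rcases hcov a b hab with h | h | h
      exacts [⟨m₁, h₁, h⟩, ⟨m₂, h₂, h⟩, ⟨m₃, h₃, h⟩]
    exact ⟨hG.contractOutside hcubic hX hcov, hG.contractOutside hcubic hXc hcov⟩
  · rintro ⟨hC, hCc⟩ H hH
    obtain ⟨u, hu⟩ : (cutEnds H.Adj X).Nonempty :=
      Set.nonempty_of_ncard_ne_zero (by simp [hX.ncard_cutEnds_of_isTwoFactor hcubic hH])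
    obtain ⟨w, hw, huw⟩ := hu.2
    have hwc : w ∈ cutEnds H.Adj Xᶜ := ⟨hw, u, by simpa using hu.1, huw.symm⟩
    have hreach (a : V) : H.spanningCoe.Reachable a u := by
      by_cases ha : a ∈ X
      · exact hX.reachable_of_contractOutside hcubic hC hH hu ha
      · exact (hXc.reachable_of_contractOutside hcubic hCc hH hwc ha).trans
          (Adj.reachable (G := H.spanningCoe) huw.symm)
    exact (connected_iff_spanningCoe_connected hH.1).mpr
      ((connected_iff _).mpr ⟨fun a b => (hreach a).trans (hreach b).symm, ⟨u⟩⟩)
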